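/- arXiv:2210.00184 — 2 statements merged into one kernel-verified Lean document; each statement's English description precedes it below -/
import Mathlib

section
/- Let m ≥ 1 be an integer, let x₁,…,xₙ and x'₁,…,x'ₙ be points of ℝ^d, let G be the n×d real matrix with rows g₁,…,gₙ, let U be the n×d matrix whose i-th row is ∇fᵢ(x'ᵢ) − ∇fᵢ(xᵢ), and define G' = W^m * (G + U). Then ‖G' − P*G'‖_F ≤ σ^m ( ‖G − P*G‖_F + L₁ · sqrt(Σᵢ ‖x'ᵢ − xᵢ‖²) ). -/
/-- Frobenius norm of an `n × d` real matrix. -/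
noncomputable def frob {n d : ℕ} (X : Matrix (Fin n) (Fin d) ℝ) : ℝ :=
  Real.sqrt (∑ i, ∑ j, (X i j) ^ 2)

open scoped Matrix.Norms.Frobenius in
theorem frob_eq_norm {n d : ℕ} (X : Matrix (Fin n) (Fin d) ℝ) : frob X = ‖X‖ := by
  simp [frob, Matrix.frobenius_norm_def, Real.sqrt_eq_rpow]

theorem frob_add_le {n d : ℕ} (X Y : Matrix (Fin n) (Fin d) ℝ) :
    frob (X + Y) ≤ frob X + frob Y := by
  simpa only [frob_eq_norm] using
    @norm_add_le _ Matrix.frobeniusNormedAddCommGroup.toSeminormedAddCommGroup.toSeminormedAddGroup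
      X Y

theorem frob_mul_le_of_mulVec_le {n d : ℕ} {σ : ℝ} (hσ : 0 ≤ σ) (A : Matrix (Fin n) (Fin n) ℝ)
    (hA : ∀ v : Fin n → ℝ,
      Real.sqrt (∑ i, (A.mulVec v i) ^ 2) ≤ σ * Real.sqrt (∑ i, (v i) ^ 2))
    (X : Matrix (Fin n) (Fin d) ℝ) : frob (A * X) ≤ σ * frob X := by
  have column_bound (j : Fin d) : ∑ i, ((A * X) i j) ^ 2 ≤ σ ^ 2 * ∑ i, (X i j) ^ 2 := by
    have h := pow_le_pow_left₀ (Real.sqrt_nonneg _) (hA fun i => X i j) 2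
    rwa [mul_pow, Real.sq_sqrt (by positivity), Real.sq_sqrt (by positivity)] at h
  refine Real.sqrt_le_iff.2 ⟨mul_nonneg hσ (Real.sqrt_nonneg _), ?_⟩
  rw [mul_pow, frob, Real.sq_sqrt (by positivity), Finset.sum_comm,
    Finset.sum_comm (f := fun i j => X i j ^ 2), Finset.mul_sum]
  exact Finset.sum_le_sum fun j _ => column_bound j

/-- Subtracting the mean does not increase the sum of squares. -/
theorem sum_sub_mean_sq_le {n : ℕ} (v : Fin n → ℝ) :
    ∑ i, (v i - ∑ k, 1 / (n : ℝ) * v k) ^ 2 ≤ ∑ i, v i ^ 2 := by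
  rcases Nat.eq_zero_or_pos n with rfl | hn
  · simp
  have hn' : (n : ℝ) ≠ 0 := by positivity
  rw [← Finset.mul_sum]
  set c := 1 / (n : ℝ) * ∑ k, v k with hc
  have hsum : ∑ k, v k = n * c := by rw [hc]; field_simp
  have hexpand : ∑ i, (v i - c) ^ 2 = ∑ i, v i ^ 2 - n * c ^ 2 := by
    simp only [sub_sq, Finset.sum_add_distrib, Finset.sum_sub_distrib, ← Finset.sum_mul,
      ← Finset.mul_sum, hsum]
    simp
    ring
  rw [hexpand]
  exact sub_le_self _ (by positivity)

theorem frob_sub_mean_le {n d : ℕ} {P : Matrix (Fin n) (Fin n) ℝ}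
    (hP : ∀ i j, P i j = 1 / (n : ℝ)) (X : Matrix (Fin n) (Fin d) ℝ) :
    frob (X - P * X) ≤ frob X := by
  refine Real.sqrt_le_sqrt ?_
  rw [Finset.sum_comm, Finset.sum_comm (f := fun i j => X i j ^ 2)]
  refine Finset.sum_le_sum fun j _ => ?_
  simpa only [Matrix.sub_apply, Matrix.mul_apply, hP] using sum_sub_mean_sq_le fun i => X i j

/-- Consensus error contracts by `σ ^ m` under `m` rounds of mixing. -/
theorem frob_pow_mul_sub_mean_le {n d : ℕ} {σ : ℝ} (hσ : 0 ≤ σ) {W P : Matrix (Fin n) (Fin n) ℝ}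
    (hWsymm : W.IsSymm) (hWrow : ∀ i, ∑ j, W i j = 1) (hP : ∀ i j, P i j = 1 / (n : ℝ))
    (hσW : ∀ v : Fin n → ℝ,
      Real.sqrt (∑ i, ((W - P).mulVec v i) ^ 2) ≤ σ * Real.sqrt (∑ i, (v i) ^ 2))
    (X : Matrix (Fin n) (Fin d) ℝ) (m : ℕ) :
    frob (W ^ m * X - P * (W ^ m * X)) ≤ σ ^ m * frob (X - P * X) := by
  have hWP : W * P = P := by
    ext i j
    simp only [Matrix.mul_apply, hP, ← Finset.sum_mul, hWrow, one_mul]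
  have hWcol (j : Fin n) : ∑ i, W i j = 1 :=
    (Finset.sum_congr rfl fun i _ => hWsymm.apply j i).trans (hWrow j)
  have hPW : P * W = P := by
    ext i j
    simp only [Matrix.mul_apply, hP, ← Finset.mul_sum, hWcol, mul_one]
  have hPP : P * P = P := by
    ext i j
    have : (n : ℝ) ≠ 0 := Nat.cast_ne_zero.2 (Fin.pos i).ne'
    simp [Matrix.mul_apply, hP, this]
  induction m with
  | zero => simp
  | succ k ih =>
    have hstep : W ^ (k + 1) * X - P * (W ^ (k + 1) * X) =
        (W - P) * (W ^ k * X - P * (W ^ k * X)) := by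
      rw [pow_succ', Matrix.mul_assoc, Matrix.sub_mul, Matrix.mul_sub, Matrix.mul_sub,
        ← Matrix.mul_assoc P W, ← Matrix.mul_assoc W P, ← Matrix.mul_assoc P P, hPW, hWP, hPP,
        sub_self, sub_zero]
    calc frob (W ^ (k + 1) * X - P * (W ^ (k + 1) * X))
        ≤ σ * frob (W ^ k * X - P * (W ^ k * X)) := by
          rw [hstep]
          exact frob_mul_le_of_mulVec_le hσ _ hσW _
      _ ≤ σ * (σ ^ k * frob (X - P * X)) := mul_le_mul_of_nonneg_left ih hσ
      _ = σ ^ (k + 1) * frob (X - P * X) := by ring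

theorem frob_le_of_row_norm_le {n d : ℕ} {L : ℝ} (hL : 0 ≤ L) (U : Matrix (Fin n) (Fin d) ℝ)
    (u y : Fin n → EuclideanSpace ℝ (Fin d)) (hU : ∀ i j, U i j = u i j)
    (h : ∀ i, ‖u i‖ ≤ L * ‖y i‖) : frob U ≤ L * Real.sqrt (∑ i, ‖y i‖ ^ 2) := by
  refine Real.sqrt_le_iff.2 ⟨by positivity, ?_⟩
  rw [mul_pow, Real.sq_sqrt (by positivity), Finset.mul_sum]
  refine Finset.sum_le_sum fun i _ => ?_
  simp only [hU, ← EuclideanSpace.real_norm_sq_eq, ← mul_pow]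
  exact pow_le_pow_left₀ (norm_nonneg _) (h i) 2

/-- Lemma 1, second inequality (gradient tracking): with
`G' = W^m * (G + U)` where the `i`-th row of `U` is `∇fᵢ(x'ᵢ) - ∇fᵢ(xᵢ)`,
`‖G' - P G'‖_F ≤ σ^m (‖G - P G‖_F + L₁ √(∑ᵢ ‖x'ᵢ - xᵢ‖²))`. -/
theorem stmt_4 (n d m : ℕ) (hn : 1 ≤ n) (hm : 1 ≤ m) (σ L₁ : ℝ)
    (hσ : 0 ≤ σ) (hL₁ : 0 < L₁)
    (W P : Matrix (Fin n) (Fin n) ℝ)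
    (hWnn : ∀ i j, 0 ≤ W i j) (hWsymm : W.IsSymm) (hWrow : ∀ i, ∑ j, W i j = 1)
    (hP : ∀ i j, P i j = 1 / (n : ℝ))
    (hσW : ∀ v : Fin n → ℝ,
      Real.sqrt (∑ i, ((W - P).mulVec v i) ^ 2) ≤ σ * Real.sqrt (∑ i, (v i) ^ 2))
    (f : Fin n → EuclideanSpace ℝ (Fin d) → ℝ)
    (hdiff : ∀ i, Differentiable ℝ (f i))
    (hLip : ∀ i (a b : EuclideanSpace ℝ (Fin d)),
      ‖gradient (f i) a - gradient (f i) b‖ ≤ L₁ * ‖a - b‖)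
    (x x' : Fin n → EuclideanSpace ℝ (Fin d))
    (G U G' : Matrix (Fin n) (Fin d) ℝ)
    (hU : ∀ i j, U i j = (gradient (f i) (x' i) - gradient (f i) (x i)) j)
    (hG' : G' = W ^ m * (G + U)) :
    frob (G' - P * G') ≤
      σ ^ m * (frob (G - P * G) + L₁ * Real.sqrt (∑ i, ‖x' i - x i‖ ^ 2)) := by
  subst hG'
  refine (frob_pow_mul_sub_mean_le hσ hWsymm hWrow hP hσW (G + U) m).trans ?_
  refine mul_le_mul_of_nonneg_left ?_ (pow_nonneg hσ m)
  calc frob (G + U - P * (G + U)) = frob ((G - P * G) + (U - P * U)) := by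
        rw [Matrix.mul_add, add_sub_add_comm]
    _ ≤ frob (G - P * G) + frob (U - P * U) := frob_add_le _ _
    _ ≤ _ := by
        gcongr
        exact (frob_sub_mean_le hP U).trans
          (frob_le_of_row_norm_le hL₁.le U _ _ hU fun i => hLip i (x' i) (x i))
end

section
/- Let M ≥ 0, M₁ > 0, α ≥ 0, c ∈ [0,1], and m ≥ 1 an integer. Let x₁,…,xₙ and g₁,…,gₙ in ℝ^d satisfy (1/n)Σᵢ gᵢ = (1/n)Σᵢ ∇fᵢ(xᵢ). For each i, let Hᵢ be a symmetric d×d real matrix with Hᵢ + M·I ⪰ M₁·I (i.e., vᵀ(Hᵢ + M I)v ≥ M₁‖v‖² for all v), and let dᵢ, rᵢ ∈ ℝ^d satisfy (Hᵢ + M·I) dᵢ = gᵢ + rᵢ with sqrt(Σᵢ ‖rᵢ‖²) ≤ c · sqrt(Σᵢ ‖gᵢ‖²). Define x'ᵢ = Σⱼ (W^m)ᵢⱼ (xⱼ − α dⱼ). Then, with x̄ = (1/n)Σᵢ xᵢ and ḡ = (1/n)Σᵢ gᵢ: sqrt(Σᵢ ‖x'ᵢ − xᵢ‖²) ≤ (2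 + 2αL₁/M₁) · sqrt(Σᵢ ‖xᵢ − x̄‖²) + (2α/M₁) · sqrt(Σᵢ ‖gᵢ − ḡ‖²) + (2α√n/M₁) · ‖∇F(x̄)‖. -/
open scoped Matrix

section BlockNorm

variable {ι E : Type*} [Fintype ι]

/-- The Euclidean norm of a finite family of vectors. -/
noncomputable def blockNorm [Norm E] (u : ι → E) : ℝ :=
  Real.sqrt (∑ i, ‖u i‖ ^ 2)

theorem blockNorm_eq_norm_toLp [SeminormedAddCommGroup E] (u : ι → E) :
    blockNorm u = ‖WithLp.toLp 2 u‖ := by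
  rw [PiLp.norm_eq_of_L2, blockNorm]

theorem blockNorm_add_le [SeminormedAddCommGroup E] (u v : ι → E) :
    blockNorm (u + v) ≤ blockNorm u + blockNorm v := by
  simp only [blockNorm_eq_norm_toLp, WithLp.toLp_add]
  exact norm_add_le _ _

theorem blockNorm_sub_le [SeminormedAddCommGroup E] (u v : ι → E) :
    blockNorm (u - v) ≤ blockNorm u + blockNorm v := by
  simp only [blockNorm_eq_norm_toLp, WithLp.toLp_sub]
  exact norm_sub_le _ _

theorem blockNorm_le_mul [SeminormedAddCommGroup E] {G : Type*} [SeminormedAddCommGroup G]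
    {u : ι → E} {v : ι → G} {a : ℝ}
    (ha : 0 ≤ a) (h : ∀ i, ‖u i‖ ≤ a * ‖v i‖) :
    blockNorm u ≤ a * blockNorm v := by
  rw [blockNorm, blockNorm, ← Real.sqrt_sq ha, ← Real.sqrt_mul (sq_nonneg a),
    Finset.mul_sum]
  gcongr with i
  rw [← mul_pow]
  exact pow_le_pow_left₀ (norm_nonneg _) (h i) 2

theorem blockNorm_const [SeminormedAddCommGroup E] (z : E) :
    blockNorm (fun _ : ι => z) = Real.sqrt (Fintype.card ι) * ‖z‖ := by
  simp [blockNorm]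

/-- Mixing a family of vectors by a doubly stochastic matrix does not increase its norm. -/
theorem blockNorm_doublyStochastic_le [SeminormedAddCommGroup E] [NormedSpace ℝ E]
    [DecidableEq ι] {P : Matrix ι ι ℝ} (hP : P ∈ doublyStochastic ℝ ι) (u : ι → E) :
    blockNorm (fun i => ∑ j, P i j • u j) ≤ blockNorm u := by
  obtain ⟨hnn, hrow, hcol⟩ := mem_doublyStochastic_iff_sum.1 hP
  have hconv : ConvexOn ℝ Set.univ fun z : E => ‖z‖ ^ 2 :=
    convexOn_univ_norm.pow (fun _ _ => norm_nonneg _) 2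
  refine Real.sqrt_le_sqrt ?_
  calc ∑ i, ‖∑ j, P i j • u j‖ ^ 2 ≤ ∑ i, ∑ j, P i j * ‖u j‖ ^ 2 :=
        Finset.sum_le_sum fun i _ =>
          hconv.map_sum_le (fun j _ => hnn i j) (hrow i) fun _ _ => Set.mem_univ _
    _ = ∑ j, ‖u j‖ ^ 2 := by
        rw [Finset.sum_comm]
        simp [← Finset.sum_mul, hcol]

theorem sqrt_card_mul_norm_average_le [SeminormedAddCommGroup E] [NormedSpace ℝ E]
    [Nonempty ι] (u : ι → E) :
    Real.sqrt (Fintype.card ι) * ‖(Fintype.card ι : ℝ)⁻¹ • ∑ i, u i‖ ≤ blockNorm u := by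
  classical
  have hP : (Matrix.of fun _ _ : ι => (Fintype.card ι : ℝ)⁻¹) ∈ doublyStochastic ℝ ι := by
    rw [mem_doublyStochastic_iff_sum]
    simp
  have h := blockNorm_doublyStochastic_le hP u
  simp only [Matrix.of_apply, ← Finset.smul_sum] at h
  rwa [blockNorm_const] at h

end BlockNorm

theorem gradient_const_mul_sum {ι E : Type*} [Fintype ι] [NormedAddCommGroup E]
    [InnerProductSpace ℝ E] [CompleteSpace E] {f : ι → E → ℝ} (a : ℝ) {y : E}
    (hf : ∀ i, DifferentiableAt ℝ (f i) y) :
    gradient (fun z => a * ∑ i, f i z) y = a • ∑ i, gradient (f i) y := by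
  simp only [gradient]
  rw [fderiv_const_mul (DifferentiableAt.fun_sum fun i _ => hf i),
    fderiv_fun_sum fun i _ => hf i]
  simp

/-- A coercive matrix expands the Euclidean norm by at least its coercivity constant. -/
theorem mul_norm_le_of_coercive {κ : Type*} [Fintype κ] {A : Matrix κ κ ℝ} {μ : ℝ}
    (hA : ∀ v : κ → ℝ, μ * ∑ j, v j ^ 2 ≤ v ⬝ᵥ A.mulVec v)
    {v b : EuclideanSpace ℝ κ} (hb : ∀ k, A.mulVec (fun j => v j) k = b k) :
    μ * ‖v‖ ≤ ‖b‖ := by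
  have hinner : (fun j => v j) ⬝ᵥ A.mulVec (fun j => v j) = inner ℝ v b := by
    simp [dotProduct, PiLp.inner_apply, hb, mul_comm]
  have h := hA fun j => v j
  rw [hinner, ← EuclideanSpace.real_norm_sq_eq] at h
  rcases (norm_nonneg v).eq_or_lt with h0 | hpos
  · simp [← h0]
  · refine le_of_mul_le_mul_right ?_ hpos
    nlinarith [real_inner_le_norm v b]

/-- Inequality (eq-11) of Lemma 2: bound on the difference between two
successive aggregated iterates of the decentralized Newton method
`x'ᵢ = ∑ⱼ (W^m)ᵢⱼ (xⱼ - α dⱼ)`, where `(Hᵢ + M I) dᵢ = gᵢ + rᵢ` with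
`Hᵢ + M I ⪰ M₁ I` and `√(∑ᵢ‖rᵢ‖²) ≤ c √(∑ᵢ‖gᵢ‖²)`. -/
theorem stmt_7 (n d m : ℕ) (hn : 1 ≤ n) (hm : 1 ≤ m)
    (M M₁ α c L₁ : ℝ) (hM : 0 ≤ M) (hM₁ : 0 < M₁) (hα : 0 ≤ α)
    (hc0 : 0 ≤ c) (hc1 : c ≤ 1) (hL₁ : 0 < L₁)
    (W : Matrix (Fin n) (Fin n) ℝ)
    (hWnn : ∀ i j, 0 ≤ W i j) (hWsymm : W.IsSymm) (hWrow : ∀ i, ∑ j, W i j = 1)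
    (f : Fin n → EuclideanSpace ℝ (Fin d) → ℝ)
    (hdiff : ∀ i, Differentiable ℝ (f i))
    (hLip : ∀ i (a b : EuclideanSpace ℝ (Fin d)),
      ‖gradient (f i) a - gradient (f i) b‖ ≤ L₁ * ‖a - b‖)
    (F : EuclideanSpace ℝ (Fin d) → ℝ)
    (hF : F = fun y => (n : ℝ)⁻¹ * ∑ i, f i y)
    (x g dv r : Fin n → EuclideanSpace ℝ (Fin d))
    (hg : (n : ℝ)⁻¹ • (∑ i, g i) = (n : ℝ)⁻¹ • (∑ i, gradient (f i) (x i)))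
    (H : Fin n → Matrix (Fin d) (Fin d) ℝ)
    (hHsymm : ∀ i, (H i).IsSymm)
    (hHpd : ∀ i (v : Fin d → ℝ),
      M₁ * ∑ j, (v j) ^ 2 ≤
        v ⬝ᵥ ((H i + M • (1 : Matrix (Fin d) (Fin d) ℝ)).mulVec v))
    (hNewton : ∀ i k,
      ((H i + M • (1 : Matrix (Fin d) (Fin d) ℝ)).mulVec (fun j => dv i j)) k
        = g i k + r i k)
    (hr : Real.sqrt (∑ i, ‖r i‖ ^ 2) ≤ c * Real.sqrt (∑ i, ‖g i‖ ^ 2))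
    (x' : Fin n → EuclideanSpace ℝ (Fin d))
    (hx' : ∀ i, x' i = ∑ j, (W ^ m) i j • (x j - α • dv j))
    (xbar gbar : EuclideanSpace ℝ (Fin d))
    (hxbar : xbar = (n : ℝ)⁻¹ • ∑ i, x i)
    (hgbar : gbar = (n : ℝ)⁻¹ • ∑ i, g i) :
    Real.sqrt (∑ i, ‖x' i - x i‖ ^ 2) ≤
      (2 + 2 * α * L₁ / M₁) * Real.sqrt (∑ i, ‖x i - xbar‖ ^ 2)
        + (2 * α / M₁) * Real.sqrt (∑ i, ‖g i - gbar‖ ^ 2)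
        + (2 * α * Real.sqrt n / M₁) * ‖gradient F xbar‖ := by
  have : NeZero n := ⟨by lia⟩
  have hW : W ∈ doublyStochastic ℝ (Fin n) := by
    refine mem_doublyStochastic_iff_sum.2 ⟨hWnn, hWrow, fun j => ?_⟩
    simpa only [hWsymm.apply] using hWrow j
  have hP := pow_mem hW m
  -- the aggregation step, recentred at the average
  have hstep : blockNorm (fun i => x' i - x i) ≤
      2 * blockNorm (fun i => x i - xbar) + α * blockNorm dv := by
    have hsplit : (fun i => x' i - x i) =
        (fun i => ∑ j, (W ^ m) i j • (((fun i => x i - xbar) - α • dv) j)) -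
          fun i => x i - xbar := by
      funext i
      have hmean : ∑ j, (W ^ m) i j • xbar = xbar := by
        rw [← Finset.sum_smul, sum_row_of_mem_doublyStochastic hP, one_smul]
      simp only [Pi.sub_apply, Pi.smul_apply, hx', sub_right_comm _ xbar, smul_sub _ _ xbar,
        Finset.sum_sub_distrib, hmean]
      abel
    have hdv : blockNorm (α • dv) ≤ α * blockNorm dv :=
      blockNorm_le_mul hα fun i => by
        simp [norm_smul, abs_of_nonneg hα]
    rw [hsplit]
    linarith [blockNorm_sub_le (fun i => ∑ j, (W ^ m) i j • (((fun i => x i - xbar) - α • dv) j))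
        fun i => x i - xbar,
      blockNorm_doublyStochastic_le hP ((fun i => x i - xbar) - α • dv),
      blockNorm_sub_le (fun i => x i - xbar) (α • dv)]
  -- the inexact Newton directions
  have hdir : blockNorm dv ≤ 2 / M₁ * blockNorm g := by
    have hres : blockNorm r ≤ blockNorm g :=
      hr.trans (mul_le_of_le_one_left (Real.sqrt_nonneg _) hc1)
    have hinv : blockNorm dv ≤ M₁⁻¹ * blockNorm (g + r) :=
      blockNorm_le_mul (by positivity) fun i => by
        rw [le_inv_mul_iff₀ hM₁]
        exact mul_norm_le_of_coercive (hHpd i) (hNewton i)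
    calc blockNorm dv ≤ M₁⁻¹ * blockNorm (g + r) := hinv
      _ ≤ M₁⁻¹ * (2 * blockNorm g) := by
          gcongr
          linarith [blockNorm_add_le g r]
      _ = 2 / M₁ * blockNorm g := by ring
  -- the tracked gradients
  have hgrad : blockNorm g ≤ blockNorm (fun i => g i - gbar) +
      (Real.sqrt n * ‖gradient F xbar‖ + L₁ * blockNorm (fun i => x i - xbar)) := by
    have hdiffmean : gbar - gradient F xbar =
        (n : ℝ)⁻¹ • ∑ i, (gradient (f i) (x i) - gradient (f i) xbar) := by
      rw [hgbar, hg, hF, gradient_const_mul_sum _ fun i => hdiff i xbar,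
        Finset.sum_sub_distrib, smul_sub]
    have hmean := sqrt_card_mul_norm_average_le
      fun i => gradient (f i) (x i) - gradient (f i) xbar
    rw [Fintype.card_fin, ← hdiffmean] at hmean
    have hlip : blockNorm (fun i => gradient (f i) (x i) - gradient (f i) xbar) ≤
        L₁ * blockNorm (fun i => x i - xbar) :=
      blockNorm_le_mul hL₁.le fun i => hLip i _ _
    have hsplit : g = (fun i => g i - gbar) + fun _ => gbar := by
      funext i
      simp
    have htri := blockNorm_add_le (fun i => g i - gbar) fun _ => gbar
    rw [← hsplit, blockNorm_const, Fintype.card_fin] at htri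
    have hgb : Real.sqrt n * ‖gbar‖ ≤
        Real.sqrt n * (‖gradient F xbar‖ + ‖gbar - gradient F xbar‖) := by
      gcongr
      exact norm_le_norm_add_norm_sub' _ _
    linarith
  change blockNorm (fun i => x' i - x i) ≤
    (2 + 2 * α * L₁ / M₁) * blockNorm (fun i => x i - xbar)
      + (2 * α / M₁) * blockNorm (fun i => g i - gbar)
      + (2 * α * Real.sqrt n / M₁) * ‖gradient F xbar‖
  calc blockNorm (fun i => x' i - x i)
      ≤ 2 * blockNorm (fun i => x i - xbar) + α * (2 / M₁ * blockNorm g) :=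
        hstep.trans (by gcongr)
    _ = 2 * blockNorm (fun i => x i - xbar) + 2 * α / M₁ * blockNorm g := by ring
    _ ≤ 2 * blockNorm (fun i => x i - xbar) + 2 * α / M₁ *
          (blockNorm (fun i => g i - gbar) +
            (Real.sqrt n * ‖gradient F xbar‖ + L₁ * blockNorm (fun i => x i - xbar))) := by
        gcongr
    _ = _ := by ring
end
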